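/- For the heat semigroup (P_t) on ℝⁿ generated by the Laplacian, with Gaussian kernel p_t(x) = (4πt)^{-n/2} exp(-|x|²/(4t)), for every bounded smooth compactly supported function f : ℝⁿ → ℝ, every t > 0 and every x ∈ ℝⁿ, one has |∇(P_t f)(x)|² ≤ (1/(2t)) · (P_t(f²)(x) − (P_t f(x))²). -/

import Mathlib

open MeasureTheory Real

section Gaussian

variable {V : Type*} [NormedAddCommGroup V] [InnerProductSpace ℝ V]

lemma hasFDerivAt_exp_neg_mul_sq_norm (b : ℝ) (z : V) :
    HasFDerivAt (fun z : V => rexp (-b * ‖z‖ ^ 2))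
      (rexp (-b * ‖z‖ ^ 2) • (-b) • (2 : ℕ) • innerSL ℝ z) z := by
  simpa using ((hasStrictFDerivAt_norm_sq z).hasFDerivAt.const_mul (-b)).exp

lemma fderiv_exp_neg_mul_sq_norm_apply (b : ℝ) (z v : V) :
    fderiv ℝ (fun z : V => rexp (-b * ‖z‖ ^ 2)) z v
      = -(2 * b) * (inner ℝ z v * rexp (-b * ‖z‖ ^ 2)) := by
  rw [(hasFDerivAt_exp_neg_mul_sq_norm b z).fderiv]
  simp
  ring

variable [FiniteDimensional ℝ V] [MeasurableSpace V] [BorelSpace V]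

lemma integrable_exp_neg_mul_sq_norm {b : ℝ} (hb : 0 < b) :
    Integrable (fun z : V => rexp (-b * ‖z‖ ^ 2)) := by
  refine Integrable.of_integral_ne_zero ?_
  rw [GaussianFourier.integral_rexp_neg_mul_sq_norm hb]
  positivity

lemma integrable_inner_sq_mul_exp_neg_mul_sq_norm {b : ℝ} (hb : 0 < b) (v : V) :
    Integrable (fun z : V => inner ℝ z v ^ 2 * rexp (-b * ‖z‖ ^ 2)) := by
  refine ((integrable_exp_neg_mul_sq_norm (half_pos hb)).const_mul (‖v‖ ^ 2 * (2 / b))).mono'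
    (by fun_prop) (.of_forall fun z => ?_)
  have h1 : inner ℝ z v ^ 2 ≤ ‖z‖ ^ 2 * ‖v‖ ^ 2 := by
    rw [← mul_pow]
    exact sq_le_sq' (neg_le_of_abs_le (abs_real_inner_le_norm z v)) (real_inner_le_norm z v)
  have h2 : b / 2 * ‖z‖ ^ 2 ≤ rexp (b / 2 * ‖z‖ ^ 2) := by
    linarith [add_one_le_exp (b / 2 * ‖z‖ ^ 2)]
  have h3 : rexp (b / 2 * ‖z‖ ^ 2) * rexp (-b * ‖z‖ ^ 2) = rexp (-(b / 2) * ‖z‖ ^ 2) := by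
    rw [← exp_add]
    ring_nf
  rw [norm_of_nonneg (by positivity)]
  calc inner ℝ z v ^ 2 * rexp (-b * ‖z‖ ^ 2)
      ≤ ‖z‖ ^ 2 * ‖v‖ ^ 2 * rexp (-b * ‖z‖ ^ 2) := by gcongr
    _ = ‖v‖ ^ 2 * (2 / b) * (b / 2 * ‖z‖ ^ 2 * rexp (-b * ‖z‖ ^ 2)) := by field_simp
    _ ≤ ‖v‖ ^ 2 * (2 / b) * (rexp (b / 2 * ‖z‖ ^ 2) * rexp (-b * ‖z‖ ^ 2)) := by gcongr
    _ = _ := by rw [h3]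

lemma integrable_inner_mul_exp_neg_mul_sq_norm {b : ℝ} (hb : 0 < b) (v : V) :
    Integrable (fun z : V => inner ℝ z v * rexp (-b * ‖z‖ ^ 2)) := by
  refine ((integrable_exp_neg_mul_sq_norm hb).add
    (integrable_inner_sq_mul_exp_neg_mul_sq_norm hb v)).mono' (by fun_prop)
    (.of_forall fun z => ?_)
  have h : |inner ℝ z v| ≤ 1 + inner ℝ z v ^ 2 := by
    rw [abs_le]
    constructor <;> nlinarith [sq_nonneg (inner ℝ z v + 1), sq_nonneg (inner ℝ z v - 1)]
  rw [norm_mul, norm_eq_abs, norm_of_nonneg (exp_pos _).le, Pi.add_apply]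
  nlinarith [mul_le_mul_of_nonneg_right h (exp_pos (-b * ‖z‖ ^ 2)).le]

lemma integral_inner_mul_exp_neg_mul_sq_norm (b : ℝ) (v : V) :
    ∫ z : V, inner ℝ z v * rexp (-b * ‖z‖ ^ 2) = 0 := by
  have h := integral_neg_eq_self (fun z : V => inner ℝ z v * rexp (-b * ‖z‖ ^ 2)) volume
  simp only [inner_neg_left, norm_neg, neg_mul, integral_neg] at h ⊢
  linarith

lemma integral_inner_sq_mul_exp_neg_mul_sq_norm {b : ℝ} (hb : 0 < b) (v : V) :
    2 * b * ∫ z : V, inner ℝ z v ^ 2 * rexp (-b * ‖z‖ ^ 2)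
      = ‖v‖ ^ 2 * ∫ z : V, rexp (-b * ‖z‖ ^ 2) := by
  have hd (z : V) : HasFDerivAt (fun z : V => inner ℝ z v) (innerSL ℝ v) z := by
    simpa [real_inner_comm] using (innerSL ℝ v).hasFDerivAt (x := z)
  have hd' (z : V) : fderiv ℝ (fun z : V => inner ℝ z v) z v = ‖v‖ ^ 2 := by
    simp [(hd z).fderiv]
  have he (z : V) : inner ℝ z v * (-(2 * b) * (inner ℝ z v * rexp (-b * ‖z‖ ^ 2)))
      = -(2 * b) * (inner ℝ z v ^ 2 * rexp (-b * ‖z‖ ^ 2)) := by ring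
  have h := integral_mul_fderiv_eq_neg_fderiv_mul_of_integrable (μ := (volume : Measure V))
    (f := fun z : V => inner ℝ z v) (g := fun z : V => rexp (-b * ‖z‖ ^ 2)) (v := v)
    (by simpa only [hd'] using (integrable_exp_neg_mul_sq_norm hb).const_mul _)
    (by simpa only [fderiv_exp_neg_mul_sq_norm_apply, he] using
      (integrable_inner_sq_mul_exp_neg_mul_sq_norm hb v).const_mul _)
    (integrable_inner_mul_exp_neg_mul_sq_norm hb v)
    (fun z _ => (hd z).differentiableAt)
    (fun z _ => (hasFDerivAt_exp_neg_mul_sq_norm b z).differentiableAt)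
  simp only [hd', fderiv_exp_neg_mul_sq_norm_apply, he, integral_const_mul] at h
  linarith

lemma integral_exp_neg_mul_sq_norm_mul_fderiv (b : ℝ) {h : V → ℝ}
    (hh : ContDiff ℝ 1 h) (hc : HasCompactSupport h) (v : V) :
    ∫ z : V, rexp (-b * ‖z‖ ^ 2) * fderiv ℝ h z v
      = 2 * b * ∫ z : V, rexp (-b * ‖z‖ ^ 2) * (inner ℝ z v * h z) := by
  have he (z : V) : -(2 * b) * (inner ℝ z v * rexp (-b * ‖z‖ ^ 2)) * h z
      = -(2 * b) * (rexp (-b * ‖z‖ ^ 2) * (inner ℝ z v * h z)) := by ring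
  have hcont := hh.continuous
  have hcont' : Continuous fun z => fderiv ℝ h z v :=
    (hh.continuous_fderiv one_ne_zero).clm_apply continuous_const
  have hint := integral_mul_fderiv_eq_neg_fderiv_mul_of_integrable (μ := (volume : Measure V))
    (f := fun z : V => rexp (-b * ‖z‖ ^ 2)) (g := h) (v := v)
    (by
      simp only [fderiv_exp_neg_mul_sq_norm_apply]
      exact Continuous.integrable_of_hasCompactSupport (by fun_prop) hc.mul_left)
    (Continuous.integrable_of_hasCompactSupport (by fun_prop)
      (hc.fderiv_apply (𝕜 := ℝ) v).mul_left)
    (Continuous.integrable_of_hasCompactSupport (by fun_prop) hc.mul_left)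
    (fun z _ => (hasFDerivAt_exp_neg_mul_sq_norm b z).differentiableAt)
    (fun z _ => hh.differentiable one_ne_zero z)
  simp only [fderiv_exp_neg_mul_sq_norm_apply, he, integral_const_mul] at hint
  linarith

/-- Cauchy–Schwarz bound, in quadratic form, for the Gaussian mean of a directional derivative
by the Gaussian variance. -/
lemma gaussian_mean_fderiv_le_variance {b K : ℝ} (hb : 0 < b) (hK : 0 ≤ K)
    (hK1 : K * ∫ z : V, rexp (-b * ‖z‖ ^ 2) = 1) {h : V → ℝ}
    (hh : ContDiff ℝ 1 h) (hc : HasCompactSupport h) (v : V) :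
    2 * (K * ∫ z : V, rexp (-b * ‖z‖ ^ 2) * fderiv ℝ h z v) - ‖v‖ ^ 2
      ≤ 2 * b * (K * (∫ z : V, rexp (-b * ‖z‖ ^ 2) * h z ^ 2)
        - (K * ∫ z : V, rexp (-b * ‖z‖ ^ 2) * h z) ^ 2) := by
  have hcont := hh.continuous
  set m := K * ∫ z : V, rexp (-b * ‖z‖ ^ 2) * h z with hm
  have hc2 : HasCompactSupport fun z => h z ^ 2 := by
    simpa only [sq] using! hc.mul_left (f := h)
  have i0 := integrable_exp_neg_mul_sq_norm (V := V) hb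
  have i1 := integrable_inner_mul_exp_neg_mul_sq_norm hb v
  have i2 := integrable_inner_sq_mul_exp_neg_mul_sq_norm hb v
  have i3 : Integrable fun z : V => rexp (-b * ‖z‖ ^ 2) * h z :=
    Continuous.integrable_of_hasCompactSupport (by fun_prop) hc.mul_left
  have i4 : Integrable fun z : V => rexp (-b * ‖z‖ ^ 2) * h z ^ 2 :=
    Continuous.integrable_of_hasCompactSupport (by fun_prop) hc2.mul_left
  have i5 : Integrable fun z : V => rexp (-b * ‖z‖ ^ 2) * (inner ℝ z v * h z) :=
    Continuous.integrable_of_hasCompactSupport (by fun_prop) hc.mul_left.mul_left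
  have hnonneg : 0 ≤ ∫ z : V, rexp (-b * ‖z‖ ^ 2) * (h z - m - inner ℝ z v) ^ 2 :=
    integral_nonneg fun z => by positivity
  have hexp (z : V) : rexp (-b * ‖z‖ ^ 2) * (h z - m - inner ℝ z v) ^ 2
      = rexp (-b * ‖z‖ ^ 2) * h z ^ 2 + m ^ 2 * rexp (-b * ‖z‖ ^ 2)
        + inner ℝ z v ^ 2 * rexp (-b * ‖z‖ ^ 2)
        + 2 * m * (inner ℝ z v * rexp (-b * ‖z‖ ^ 2))
        + -2 * m * (rexp (-b * ‖z‖ ^ 2) * h z)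
        + -2 * (rexp (-b * ‖z‖ ^ 2) * (inner ℝ z v * h z)) := by ring
  simp only [hexp] at hnonneg
  rw [integral_add (by fun_prop) (by fun_prop), integral_add (by fun_prop) (by fun_prop),
    integral_add (by fun_prop) (by fun_prop), integral_add (by fun_prop) (by fun_prop),
    integral_add (by fun_prop) (by fun_prop)] at hnonneg
  simp only [integral_const_mul, integral_inner_mul_exp_neg_mul_sq_norm] at hnonneg
  have hE := integral_inner_sq_mul_exp_neg_mul_sq_norm hb v
  rw [integral_exp_neg_mul_sq_norm_mul_fderiv b hh hc]
  have hmul := mul_nonneg (mul_nonneg (mul_nonneg zero_le_two hb.le) hK) hnonneg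
  linear_combination hmul + K * hE + (‖v‖ ^ 2 + 2 * b * m ^ 2) * hK1 + 4 * b * m * hm

lemma hasFDerivAt_integral_exp_neg_mul_sq_norm_sub_mul (b : ℝ) {f : V → ℝ}
    (hf : ContDiff ℝ 1 f) (hc : HasCompactSupport f) (x : V) :
    ∃ L : V →L[ℝ] ℝ, HasFDerivAt (fun x => ∫ z, rexp (-b * ‖z‖ ^ 2) * f (x - z)) L x ∧
      ∀ v, L v = ∫ z, rexp (-b * ‖z‖ ^ 2) * fderiv ℝ f (x - z) v := by
  have hloc : LocallyIntegrable (fun z : V => rexp (-b * ‖z‖ ^ 2)) :=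
    Continuous.locallyIntegrable (by fun_prop)
  refine ⟨_, hc.hasFDerivAt_convolution_right (ContinuousLinearMap.mul ℝ ℝ) hloc hf x, fun v => ?_⟩
  rw [convolution_precompR_apply _ hloc (hc.fderiv ℝ) (hf.continuous_fderiv one_ne_zero)]
  rfl

end Gaussian

/-- Reverse Poincaré inequality for the Euclidean heat semigroup with sharp
constant `1/(2t)`. -/
theorem reverse_poincare_heat_semigroup_euclidean (n : ℕ)
    (p : ℝ → EuclideanSpace ℝ (Fin n) → ℝ)
    (hp : ∀ t x, p t x = (4 * π * t) ^ (-(n : ℝ) / 2) * Real.exp (-‖x‖ ^ 2 / (4 * t)))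
    (P : ℝ → (EuclideanSpace ℝ (Fin n) → ℝ) → EuclideanSpace ℝ (Fin n) → ℝ)
    (hP : ∀ t f x, P t f x = ∫ y, p t (x - y) * f y)
    (f : EuclideanSpace ℝ (Fin n) → ℝ)
    (hf : ContDiff ℝ (⊤ : ℕ∞) f) (hsupp : HasCompactSupport f)
    (t : ℝ) (ht : 0 < t) (x : EuclideanSpace ℝ (Fin n)) :
    ‖gradient (P t f) x‖ ^ 2 ≤ (1 / (2 * t)) * (P t (fun y => f y ^ 2) x - (P t f x) ^ 2) := by
  set b : ℝ := 1 / (4 * t) with hb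
  have hb0 : 0 < b := by positivity
  set K : ℝ := (4 * π * t) ^ (-(n : ℝ) / 2) with hK
  have hK0 : 0 ≤ K := by positivity
  have hK1 : K * ∫ z : EuclideanSpace ℝ (Fin n), rexp (-b * ‖z‖ ^ 2) = 1 := by
    rw [GaussianFourier.integral_rexp_neg_mul_sq_norm hb0, finrank_euclideanSpace_fin,
      show π / b = 4 * π * t by rw [hb]; field_simp, hK, ← rpow_add (by positivity)]
    ring_nf
    simp
  have hPK (g : EuclideanSpace ℝ (Fin n) → ℝ) (x : EuclideanSpace ℝ (Fin n)) :
      P t g x = K * ∫ z, rexp (-b * ‖z‖ ^ 2) * g (x - z) := by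
    rw [hP, ← integral_sub_left_eq_self _ volume x, ← integral_const_mul]
    congr with z
    rw [hp, sub_sub_cancel, mul_assoc, show -‖z‖ ^ 2 / (4 * t) = -b * ‖z‖ ^ 2 by rw [hb]; ring]
  have hf1 : ContDiff ℝ 1 f := hf.of_le (by exact_mod_cast le_top)
  have hh : ContDiff ℝ 1 fun z => f (x - z) := by fun_prop
  have hc : HasCompactSupport fun z => f (x - z) :=
    hsupp.comp_homeomorph (Homeomorph.subLeft x)
  have hfd (z v : EuclideanSpace ℝ (Fin n)) :
      fderiv ℝ (fun z => f (x - z)) z v = -fderiv ℝ f (x - z) v := by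
    have hd : HasFDerivAt (fun z => f (x - z)) _ z :=
      (hf1.differentiable one_ne_zero (x - z)).hasFDerivAt.comp z ((hasFDerivAt_id z).const_sub x)
    simp [hd.fderiv]
  obtain ⟨L, hL, hLv⟩ := hasFDerivAt_integral_exp_neg_mul_sq_norm_sub_mul b hf1 hsupp x
  set g := gradient (P t f) x with hg
  have hgg : ‖g‖ ^ 2 = K * ∫ z, rexp (-b * ‖z‖ ^ 2) * fderiv ℝ (fun z => f (x - z)) z (-g) := by
    rw [← real_inner_self_eq_norm_sq]
    nth_rewrite 1 [hg]
    rw [inner_gradient_left, funext (hPK f), (hL.const_mul K).fderiv, smul_apply,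
      hLv, smul_eq_mul]
    simp [hfd]
  have key := gaussian_mean_fderiv_le_variance hb0 hK0 hK1 hh hc (-g)
  rw [← hgg, norm_neg, ← hPK f, ← hPK (fun y => f y ^ 2)] at key
  rw [show 1 / (2 * t) = 2 * b by rw [hb]; field_simp; norm_num]
  linarith
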